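/- arXiv:1806.01566 — 2 statements merged into one kernel-verified Lean document; each statement's English description precedes it below -/
import Mathlib

section
/- Let X be a completely regular topological space and let A be a subspace of X that is C*-embedded in X (every continuous map A → [0,1] extends to a continuous map X → [0,1]). Then for every finite cover α₁, …, αₙ of A by sets that are functionally open in A, there exists a finite cover γ₁, …, γₙ, γₙ₊₁ of X by sets that are functionally open in X such that γᵢ ∩ A ⊆ αᵢ for each i = 1, …, n and γₙ₊₁ ∩ A = ∅. In particular, the traces on A of finite functionally open covers of X form a cofinal subset (with respect to refinement) of the set of finite functionally open covers of A. -/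
/-- A set `U` is functionally open (a cozero set) if `U = f ⁻¹' (0,1]` for some
continuous `f : X → [0,1]`. -/
def IsFunctionallyOpen {X : Type*} [TopologicalSpace X] (U : Set X) : Prop :=
  ∃ f : X → ℝ, Continuous f ∧ (∀ x, f x ∈ Set.Icc (0 : ℝ) 1) ∧
    U = f ⁻¹' Set.Ioc (0 : ℝ) 1

/-- The positivity set of a continuous `[0,1]`-valued function is functionally open. -/
theorem isFunctionallyOpen_setOf_pos {X : Type*} [TopologicalSpace X] {f : X → ℝ}
    (hf : Continuous f) (hf01 : ∀ x, f x ∈ Set.Icc (0 : ℝ) 1) :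
    IsFunctionallyOpen {x | 0 < f x} :=
  ⟨f, hf, hf01, Set.ext fun x => ⟨fun h => ⟨h, (hf01 x).2⟩, fun h => h.1⟩⟩

/-- If `A` is a C*-embedded subspace of a completely regular space `X`, then every finite
functionally open cover of `A` is "almost extendable": there is a finite functionally open
cover `γ₁, …, γₙ, γₙ₊₁` of `X` with `γᵢ ∩ A ⊆ αᵢ` and `γₙ₊₁ ∩ A = ∅`. -/
theorem cstar_embedded_functionally_open_cover_extension
    {X : Type*} [TopologicalSpace X] [CompletelyRegularSpace X] (A : Set X)
    (hCstar : ∀ f : A → ℝ, Continuous f → (∀ a, f a ∈ Set.Icc (0 : ℝ) 1) →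
      ∃ g : X → ℝ, Continuous g ∧ (∀ x, g x ∈ Set.Icc (0 : ℝ) 1) ∧ ∀ a : A, g a = f a)
    (n : ℕ) (α : Fin n → Set A)
    (hα : ∀ i, IsFunctionallyOpen (α i)) (hαcov : ⋃ i, α i = Set.univ) :
    ∃ γ : Fin (n + 1) → Set X,
      (∀ j, IsFunctionallyOpen (γ j)) ∧
      (⋃ j, γ j = Set.univ) ∧
      (∀ i : Fin n, (Subtype.val : A → X) ⁻¹' γ i.castSucc ⊆ α i) ∧
      (Subtype.val : A → X) ⁻¹' γ (Fin.last n) = ∅ := by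
  choose f hf hf01 hαf using hα
  have hpos : ∀ a, 0 < ∑ i, f i a := by
    intro a
    have ha : a ∈ ⋃ i, α i := hαcov ▸ Set.mem_univ a
    obtain ⟨i, hi⟩ := Set.mem_iUnion.1 ha
    rw [hαf i] at hi
    exact Finset.sum_pos' (fun j _ => (hf01 j a).1) ⟨i, Finset.mem_univ i, hi.1⟩
  have hext : ∀ i, ∃ g : X → ℝ, Continuous g ∧ (∀ x, g x ∈ Set.Icc (0 : ℝ) 1) ∧
      ∀ a : A, g a = f i a / ∑ j, f j a := by
    intro i
    refine hCstar (fun a => f i a / ∑ j, f j a)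
      ((hf i).div (continuous_finsetSum _ fun j _ => hf j) fun a => (hpos a).ne') fun a => ?_
    exact ⟨div_nonneg (hf01 i a).1 (hpos a).le, (div_le_one (hpos a)).2
      (Finset.single_le_sum (fun j _ => (hf01 j a).1) (Finset.mem_univ i))⟩
  choose g hg hg01 hgf using hext
  have hsum : ∀ a : A, ∑ i, g i a = 1 := by
    intro a
    simp_rw [hgf, ← Finset.sum_div]
    exact div_self (hpos a).ne'
  let r : X → ℝ := fun x => max 0 (1 - ∑ i, g i x)
  have hr : Continuous r :=
    continuous_const.max (continuous_const.sub (continuous_finsetSum _ fun i _ => hg i))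
  have hr01 : ∀ x, r x ∈ Set.Icc (0 : ℝ) 1 := fun x =>
    ⟨le_max_left _ _, max_le zero_le_one
      (sub_le_self _ (Finset.sum_nonneg fun i _ => (hg01 i x).1))⟩
  refine ⟨Fin.snoc (fun i => {x | 0 < g i x}) {x | 0 < r x}, fun j => ?_, ?_, fun i => ?_, ?_⟩
  · induction j using Fin.lastCases with
    | last => simpa using isFunctionallyOpen_setOf_pos hr hr01
    | cast i => simpa using isFunctionallyOpen_setOf_pos (hg i) (hg01 i)
  · refine Set.eq_univ_of_forall fun x => Set.mem_iUnion.2 ?_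
    by_cases hx : ∃ i, 0 < g i x
    · obtain ⟨i, hi⟩ := hx
      exact ⟨i.castSucc, by simpa using hi⟩
    · push Not at hx
      have hx0 : ∑ i, g i x = 0 :=
        Finset.sum_eq_zero fun i _ => le_antisymm (hx i) (hg01 i x).1
      exact ⟨Fin.last n, by simp [r, hx0]⟩
  · intro a ha
    have hga : 0 < g i a := by simpa using ha
    rw [hgf, div_pos_iff_of_pos_right (hpos a)] at hga
    rw [hαf i]
    exact ⟨hga, (hf01 i a).2⟩
  · ext a
    simp [r, hsum a]
end

section
/- Let X be a Tychonoff (completely regular Hausdorff) space with Stone–Čech compactification βX. Then the family of covers of X of the form { e⁻¹(B) : B ∈ β }, where e : X → βX is the canonical embedding and β ranges over all finite functionally open covers of βX, is a cofinal subset (with respect to refinement) of the set of all finite functionally open covers of X. -/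
theorem IsFunctionallyOpen.preimage {X Y : Type*} [TopologicalSpace X] [TopologicalSpace Y]
    {U : Set Y} (hU : IsFunctionallyOpen U) {g : X → Y} (hg : Continuous g) :
    IsFunctionallyOpen (g ⁻¹' U) := by
  obtain ⟨f, hf, hI, rfl⟩ := hU
  exact ⟨f ∘ g, hf.comp hg, fun x => hI (g x), rfl⟩

/-- The members of a finite functionally open cover are the cozero sets of a continuous
partition of unity. -/
theorem exists_partition_of_unity_of_functionallyOpen_cover {X ι : Type*} [TopologicalSpace X]
    [Fintype ι] {α : ι → Set X} (hα : ∀ i, IsFunctionallyOpen (α i)) (hcov : ⋃ i, α i = Set.univ) :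
    ∃ g : ι → X → Set.Icc (0 : ℝ) 1, (∀ i, Continuous (g i)) ∧
      (∀ x, ∑ i, (g i x : ℝ) = 1) ∧ ∀ i x, x ∈ α i ↔ 0 < (g i x : ℝ) := by
  choose f hf hI hfα using hα
  have mem_iff (i : ι) (x : X) : x ∈ α i ↔ 0 < f i x := by
    rw [hfα i]
    exact ⟨fun h => h.1, fun h => ⟨h, (hI i x).2⟩⟩
  have sum_pos (x : X) : 0 < ∑ i, f i x := by
    obtain ⟨i, hi⟩ := Set.mem_iUnion.1 (hcov ▸ Set.mem_univ x)
    exact Finset.sum_pos' (fun j _ => (hI j x).1) ⟨i, Finset.mem_univ i, (mem_iff i x).1 hi⟩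
  refine ⟨fun i x => ⟨f i x / ∑ j, f j x, div_nonneg (hI i x).1 (sum_pos x).le,
    div_le_one_of_le₀ (Finset.single_le_sum (f := fun j => f j x) (fun j _ => (hI j x).1)
      (Finset.mem_univ i)) (sum_pos x).le⟩, fun i => ?_, fun x => ?_, fun i x => ?_⟩
  · exact ((hf i).div (continuous_finsetSum _ fun j _ => hf j)
      fun x => (sum_pos x).ne').subtype_mk _
  · simp only [← Finset.sum_div]
    exact div_self (sum_pos x).ne'
  · rw [mem_iff, div_pos_iff_of_pos_right (sum_pos x)]

/-- For a Tychonoff space `X` with canonical embedding `e = stoneCechUnit : X → βX`,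
the traces on `X` of finite functionally open covers of `βX` form a cofinal subset of the
set of finite functionally open covers of `X`: (1) every such trace is itself a finite
functionally open cover of `X`, and (2) every finite functionally open cover of `X` is
refined by such a trace. -/
theorem trace_of_stoneCech_covers_cofinal
    {X : Type*} [TopologicalSpace X] [T35Space X] :
    (∀ (m : ℕ) (β : Fin m → Set (StoneCech X)),
      (∀ j, IsFunctionallyOpen (β j)) → (⋃ j, β j = Set.univ) →
        ((∀ j, IsFunctionallyOpen (stoneCechUnit ⁻¹' β j)) ∧
          ⋃ j, stoneCechUnit ⁻¹' β j = Set.univ)) ∧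
    (∀ (n : ℕ) (α : Fin n → Set X),
      (∀ i, IsFunctionallyOpen (α i)) → (⋃ i, α i = Set.univ) →
        ∃ (m : ℕ) (β : Fin m → Set (StoneCech X)),
          (∀ j, IsFunctionallyOpen (β j)) ∧ (⋃ j, β j = Set.univ) ∧
          (∀ j, ∃ i, stoneCechUnit ⁻¹' β j ⊆ α i)) := by
  refine ⟨fun m β hβ hcov => ⟨fun j => (hβ j).preimage continuous_stoneCechUnit, ?_⟩,
    fun n α hα hcov => ?_⟩
  · rw [← Set.preimage_iUnion, hcov, Set.preimage_univ]
  · obtain ⟨g, hg, hsum, hpos⟩ := exists_partition_of_unity_of_functionallyOpen_cover hα hcov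
    let G (i : Fin n) : StoneCech X → Set.Icc (0 : ℝ) 1 := stoneCechExtend (hg i)
    have hG (i : Fin n) : Continuous fun y => (G i y : ℝ) :=
      continuous_subtype_val.comp (continuous_stoneCechExtend (hg i))
    have hGsum : (fun y => ∑ i, (G i y : ℝ)) = fun _ => 1 :=
      denseRange_stoneCechUnit.equalizer (continuous_finsetSum _ fun i _ => hG i)
        continuous_const (funext fun x => by simp [G, stoneCechExtend_stoneCechUnit, hsum])
    refine ⟨n, fun i => (fun y => (G i y : ℝ)) ⁻¹' Set.Ioc 0 1,
      fun i => ⟨_, hG i, fun y => (G i y).2, rfl⟩,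
      Set.eq_univ_of_forall fun y => ?_, fun i => ⟨i, fun x hx => ?_⟩⟩
    · have hy : 0 < ∑ i, (G i y : ℝ) :=
        (congrFun hGsum y).symm ▸ zero_lt_one
      obtain ⟨i, -, hi⟩ := Finset.exists_lt_of_sum_lt (s := Finset.univ) (f := fun _ => (0 : ℝ))
        (by simpa using hy)
      exact Set.mem_iUnion.2 ⟨i, hi, (G i y).2.2⟩
    · rw [hpos, ← stoneCechExtend_stoneCechUnit (hg i) x]
      exact hx.1
end
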